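/- Let p be a prime and B a commutative local integral domain in which p = 0, with maximal ideal m. Let D : B → B be a nonzero derivation which is p-closed (D^[p] = h•D for some h ∈ B) and satisfies D(B) ⊆ m. Let a ∈ m with a ≠ 0, and suppose h₁ ∈ B satisfies (a•D)^[p] = h₁•(a•D). Then h₁ is not a unit of B. -/

import Mathlib

namespace Derivation

open Finset

/-- The general Leibniz rule for a derivation of a commutative ring. -/
theorem iterate_apply_mul {R B : Type*} [CommRing R] [CommRing B] [Algebra R B]
    (D : Derivation R B B) (n : ℕ) (x y : B) :
    D^[n] (x * y) = ∑ i ∈ range (n + 1), (n.choose i : B) * D^[n - i] x * D^[i] y := by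
  have key : D^[n] (x * y) =
      ∑ ij ∈ antidiagonal n, (n.choose ij.1 : B) * (D^[ij.1] y * D^[ij.2] x) := by
    induction n with
    | zero => simp [mul_comm]
    | succ n ih =>
      rw [sum_antidiagonal_choose_succ_mul (fun i j => D^[i] y * D^[j] x) n]
      simp only [Function.iterate_succ_apply', ih, map_sum, leibniz, smul_eq_mul, map_natCast,
        mul_zero, add_zero, mul_add, sum_add_distrib]
      congr 1
      refine sum_congr rfl fun ⟨i, j⟩ hij ↦ ?_
      rw [n.choose_symm_of_eq_add (mem_antidiagonal.1 hij).symm]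
      ring
  rw [key, Finset.Nat.sum_antidiagonal_eq_sum_range_succ
    (fun i j => (n.choose i : B) * (D^[i] y * D^[j] x))]
  exact sum_congr rfl fun i _ => by ring

/-- Over a domain, the iterates `D^[0], …, D^[k - 1]` of a nonzero derivation are linearly
independent as soon as `1, …, k - 1` are nonzero in the domain. -/
theorem eq_zero_of_sum_mul_iterate_eq_zero {R B : Type*} [CommRing R] [CommRing B] [IsDomain B]
    [Algebra R B] (D : Derivation R B B) {x : B} (hx : D x ≠ 0) (k : ℕ)
    (hk : ∀ j, 0 < j → j < k → (j : B) ≠ 0) (b : ℕ → B)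
    (hb : ∀ y, ∑ i ∈ range k, b i * D^[i] y = 0) : ∀ i < k, b i = 0 := by
  induction k generalizing b with
  | zero => simp
  | succ k ih =>
    have hk' : ∀ j, 0 < j → j < k → (j : B) ≠ 0 := fun j h₀ h => hk j h₀ (by lia)
    have htop : b k = 0 := by
      obtain _ | k := k
      · simpa using hb 1
      set c : ℕ → B := fun j =>
        (∑ i ∈ range (k + 2), b i * (i.choose j : B) * D^[i - j] x) - x * b j with hc
      have hsum : ∀ y, ∑ j ∈ range (k + 2), c j * D^[j] y = 0 := by
        intro y
        have h₁ := hb (x * y)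
        have h₂ : ∀ i ∈ range (k + 2), b i * D^[i] (x * y) =
            ∑ j ∈ range (k + 2), b i * (i.choose j : B) * D^[i - j] x * D^[j] y := by
          intro i hi
          rw [iterate_apply_mul, mul_sum]
          refine sum_subset_zero_on_sdiff (range_mono (by simp at hi; lia)) ?_ ?_
          · intro j hj
            simp only [mem_sdiff, mem_range] at hj
            simp [Nat.choose_eq_zero_of_lt (show i < j by lia)]
          · intro j _
            ring
        rw [sum_congr rfl h₂, sum_comm] at h₁
        simp only [hc, sub_mul, sum_sub_distrib, sum_mul, h₁, mul_assoc x, ← mul_sum, hb y]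
        simp
      have hck1 : c (k + 1) = 0 := by
        simp only [hc]
        rw [sum_range_succ, sum_eq_zero]
        · simp [mul_comm]
        · intro i hi
          simp [Nat.choose_eq_zero_of_lt (mem_range.1 hi)]
      have hck : c k = b (k + 1) * ((k + 1 : ℕ) : B) * D x := by
        simp only [hc]
        rw [sum_range_succ, sum_range_succ, sum_eq_zero]
        · simp [mul_comm]
        · intro i hi
          simp [Nat.choose_eq_zero_of_lt (mem_range.1 hi)]
      have hck0 : c k = 0 := by
        refine ih hk' c (fun y => ?_) k (by lia)
        have := hsum y
        rwa [sum_range_succ, hck1, zero_mul, add_zero] at this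
      rw [hck] at hck0
      simpa [hx, -Nat.cast_add, hk (k + 1) (by lia) (by lia)] using hck0
    intro i hi
    obtain rfl | hi : i = k ∨ i < k := by lia
    · exact htop
    · refine ih hk' b (fun y => ?_) i hi
      have := hb y
      rwa [sum_range_succ, htop, zero_mul, add_zero] at this

/-- Expansion of the iterates of `a • D` in terms of those of `D`: the coefficient of `D^[n + 2]`
in `(a • D)^[n + 2]` is `a ^ (n + 2)`, and that of `D` is `a` times a value of `D`. -/
theorem exists_iterate_smul_apply_eq_sum {R B : Type*} [CommRing R] [CommRing B] [Algebra R B]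
    (D : Derivation R B B) (a : B) (n : ℕ) :
    ∃ c : ℕ → B, (∃ e, c 0 = a * D e) ∧ c (n + 1) = a ^ (n + 2) ∧ (∀ i, n + 2 ≤ i → c i = 0) ∧
      ∀ y, (⇑(a • D))^[n + 2] y = ∑ i ∈ range (n + 2), c i * D^[i + 1] y := by
  induction n with
  | zero =>
    refine ⟨fun i => if i = 0 then a * D a else if i = 1 then a ^ 2 else 0, ⟨a, by simp⟩,
      by simp, fun i hi => ?_, fun y => ?_⟩
    · simp [show i ≠ 0 by lia, show i ≠ 1 by lia]
    · simp [sum_range_succ]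
      ring
  | succ n ih =>
    obtain ⟨c, -, htop, hzero, hc⟩ := ih
    refine ⟨fun i => a * (D (c i) + if i = 0 then 0 else c (i - 1)), ⟨c 0, by simp⟩, ?_, ?_, ?_⟩
    · simp [hzero (n + 2) le_rfl, htop]
      ring
    · intro i hi
      simp [hzero i (by lia), hzero (i - 1) (by lia)]
    · intro y
      rw [Function.iterate_succ_apply', hc]
      simp only [coe_smul, Pi.smul_apply, smul_eq_mul, map_sum, leibniz, mul_assoc, add_mul,
        ← mul_sum, sum_add_distrib]
      rw [sum_range_succ _ (n + 2), sum_range_succ' _ (n + 2), hzero (n + 2) le_rfl]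
      simp only [Function.iterate_succ_apply', map_zero, zero_mul, add_zero, if_true,
        Nat.add_eq_zero_iff, one_ne_zero, and_false, if_false, Nat.add_sub_cancel]
      simp [mul_comm, mul_add, mul_sum, mul_left_comm, mul_assoc, add_comm]

end Derivation


/-- If `B` is a local domain of characteristic `p`, `D` a nonzero `p`-closed derivation
with image contained in the maximal ideal, and `a ∈ 𝔪 \ {0}`, then any multiplier `h₁`
with `(aD)^[p] = h₁ • (aD)` is a non-unit. -/
theorem multiplier_of_smul_not_isUnit (p : ℕ) (hp : p.Prime) (B : Type*) [CommRing B]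
    [IsLocalRing B] [IsDomain B] (hcharB : (p : B) = 0)
    (D : Derivation ℤ B B) (hD0 : D ≠ 0)
    (hpclosed : ∃ h : B, ∀ x, (⇑D)^[p] x = h * D x)
    (himage : ∀ x, D x ∈ IsLocalRing.maximalIdeal B)
    (a : B) (ha : a ∈ IsLocalRing.maximalIdeal B) (ha0 : a ≠ 0)
    (h₁ : B) (hh₁ : ∀ x, (⇑(a • D))^[p] x = h₁ * (a • D) x) :
    ¬ IsUnit h₁ := by
  intro hu
  obtain ⟨h, hh⟩ := hpclosed
  obtain ⟨x, hx⟩ : ∃ x, D x ≠ 0 := by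
    by_contra! hD
    exact hD0 (Derivation.ext hD)
  obtain ⟨n, rfl⟩ : ∃ n, p = n + 2 := ⟨p - 2, by have := hp.two_le; lia⟩
  have : CharP B (n + 2) := (CharP.charP_iff_prime_eq_zero hp).2 hcharB
  obtain ⟨c, ⟨e, hc0⟩, htop, -, hc⟩ := D.exists_iterate_smul_apply_eq_sum a n
  have hlin := D.eq_zero_of_sum_mul_iterate_eq_zero hx (n + 2)
    (fun j h₀ hj hj' => Nat.not_dvd_of_pos_of_lt h₀ hj ((CharP.cast_eq_zero_iff B (n + 2) j).1 hj'))
    (fun i => (if i = 0 then 0 else c (i - 1)) +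
      if i = 1 then a ^ (n + 2) * h - h₁ * a else 0)
    (fun y => by
      have h₂ := hh₁ y
      rw [hc, Finset.sum_range_succ, htop, hh] at h₂
      simp only [Derivation.coe_smul, Pi.smul_apply, smul_eq_mul] at h₂
      rw [Finset.sum_range_succ']
      simp only [add_mul, Finset.sum_add_distrib]
      simp [-Function.iterate_succ]
      linear_combination h₂) 1 (by lia)
  simp only [one_ne_zero, if_true, if_false, Nat.sub_self, hc0] at hlin
  have heq : h₁ = D e + a ^ (n + 1) * h :=
    mul_left_cancel₀ ha0 (by linear_combination -hlin)
  refine (IsLocalRing.mem_maximalIdeal h₁).1 ?_ hu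
  rw [heq]
  exact add_mem (himage e) (Ideal.mul_mem_right _ _ (Ideal.pow_mem_of_mem _ ha _ (by lia)))
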